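/- Let n, k ≥ 2 be integers and fix p with 1 ≤ p ≤ ∞. Define, for natural numbers s, t, the mapping ratio e_ρ(ℤ^n, ℤ^k, s, t) = #{(u,v) ∈ ℤ^n×ℤ^k : ‖u‖_p ≤ s, ‖v‖_p ≤ t, and φ(u) = v for some group homomorphism φ : ℤ^n → ℤ^k} / (#{u ∈ ℤ^n : ‖u‖_p ≤ s} · #{v ∈ ℤ^k : ‖v‖_p ≤ t}). Then 1/ζ(n) ≤ liminf_{(s,t)→(∞,∞)} e_ρ(ℤ^n, ℤ^k, s, t). -/

import Mathlib

open Filter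

/-- The Riemann zeta function at a natural number argument, ζ(r) = Σ_{m≥1} m^{-r}. -/
noncomputable def zetaR (r : ℕ) : ℝ := ∑' m : ℕ, 1 / ((m : ℝ) + 1) ^ r

/-- The ℓ_p length of an integer vector, for an extended exponent `p` with `1 ≤ p ≤ ∞`:
the sup-norm when `p = ∞`, and `(Σ_i |z_i|^p)^{1/p}` for finite `p`. -/
noncomputable def lpLen (p : ENNReal) {r : ℕ} (z : Fin r → ℤ) : ℝ :=
  if p = ⊤ then ((Finset.univ.sup fun i => (z i).natAbs : ℕ) : ℝ)
  else (∑ i, |((z i : ℤ) : ℝ)| ^ p.toReal) ^ (1 / p.toReal)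

/-- The `(s,t)`-mapping ratio `e_ρ(ℤ^n, ℤ^k, s, t)`: the proportion, among all pairs
`(u,v) ∈ ℤ^n × ℤ^k` with `‖u‖_p ≤ s` and `‖v‖_p ≤ t`, of those pairs for which `v` is the
image of `u` under some group homomorphism `ℤ^n → ℤ^k`. -/
noncomputable def eRho (p : ENNReal) (n k : ℕ) (s t : ℕ) : ℝ :=
  ({uv : (Fin n → ℤ) × (Fin k → ℤ) |
      lpLen p uv.1 ≤ (s : ℝ) ∧ lpLen p uv.2 ≤ (t : ℝ) ∧
      ∃ φ : (Fin n → ℤ) →+ (Fin k → ℤ), φ uv.1 = uv.2}.ncard : ℝ) /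
    (({u : Fin n → ℤ | lpLen p u ≤ (s : ℝ)}.ncard : ℝ) *
      ({v : Fin k → ℤ | lpLen p v ≤ (t : ℝ)}.ncard : ℝ))

section LpLength

variable {p : ENNReal} {r : ℕ}

lemma lpLen_eq_norm (hp : 1 ≤ p) (z : Fin r → ℤ) :
    lpLen p z = ‖WithLp.toLp p (fun i => (z i : ℝ))‖ := by
  unfold lpLen
  split_ifs with h
  · subst h
    rw [PiLp.norm_toLp, Pi.norm_def, ← NNReal.coe_natCast, NNReal.coe_inj,
      Finset.apply_sup_eq_sup_comp (Nat.cast : ℕ → NNReal) (fun _ _ => Nat.cast_max _ _) (by simp)]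
    congr 1
    ext i
    simp [Nat.cast_natAbs]
  · have hp' : 0 < p.toReal := ENNReal.toReal_pos (zero_lt_one.trans_le hp).ne' h
    rw [PiLp.norm_eq_sum hp']
    simp

lemma lpLen_zero (hp : 1 ≤ p) : lpLen p (0 : Fin r → ℤ) = 0 := by
  have : Fact (1 ≤ p) := ⟨hp⟩
  rw [lpLen_eq_norm hp]
  have h : WithLp.toLp p (fun i => (((0 : Fin r → ℤ) i : ℤ) : ℝ)) = 0 := by
    ext i
    simp
  rw [h, norm_zero]

lemma lpLen_nsmul (hp : 1 ≤ p) (d : ℕ) (z : Fin r → ℤ) :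
    lpLen p (d • z) = d * lpLen p z := by
  have : Fact (1 ≤ p) := ⟨hp⟩
  rw [lpLen_eq_norm hp, lpLen_eq_norm hp]
  have h : WithLp.toLp p (fun i => (((d • z) i : ℤ) : ℝ)) =
      (d : ℝ) • WithLp.toLp p (fun i => (z i : ℝ)) := by
    ext i
    simp
  rw [h, norm_smul]
  simp

lemma abs_apply_le_lpLen (hp : 1 ≤ p) (z : Fin r → ℤ) (i : Fin r) :
    |(z i : ℝ)| ≤ lpLen p z := by
  have : Fact (1 ≤ p) := ⟨hp⟩
  rw [lpLen_eq_norm hp]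
  simpa using PiLp.norm_apply_le (WithLp.toLp p (fun i => (z i : ℝ))) i

/-- The integer points of length at most `x`. -/
def intBall (p : ENNReal) (r : ℕ) (x : ℝ) : Set (Fin r → ℤ) := {u | lpLen p u ≤ x}

lemma intBall_subset (hp : 1 ≤ p) (x : ℝ) :
    intBall p r x ⊆ (Fintype.piFinset fun _ : Fin r => Finset.Icc (-⌊x⌋) ⌊x⌋ :
      Finset (Fin r → ℤ)) := by
  intro u hu
  simp only [Finset.mem_coe, Fintype.mem_piFinset, Finset.mem_Icc]
  intro i
  have h := abs_le.mp ((abs_apply_le_lpLen hp u i).trans hu)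
  refine ⟨?_, Int.le_floor.mpr h.2⟩
  rw [neg_le]
  exact Int.le_floor.mpr (by push_cast; linarith)

lemma intBall_finite (hp : 1 ≤ p) (x : ℝ) : (intBall p r x).Finite :=
  (Finset.finite_toSet _).subset (intBall_subset hp x)

lemma zero_mem_intBall (hp : 1 ≤ p) {x : ℝ} (hx : 0 ≤ x) : 0 ∈ intBall p r x := by
  simpa [intBall, lpLen_zero hp] using hx

lemma ncard_intBall_pos (hp : 1 ≤ p) {x : ℝ} (hx : 0 ≤ x) : 0 < (intBall p r x).ncard :=
  (Set.ncard_pos (intBall_finite hp x)).mpr ⟨0, zero_mem_intBall hp hx⟩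

lemma ncard_intBall_le (hp : 1 ≤ p) {x : ℝ} (hx : 1 ≤ x) :
    ((intBall p r x).ncard : ℝ) ≤ (3 * x) ^ r := by
  have h1 := Set.ncard_le_ncard (intBall_subset (r := r) hp x) (Finset.finite_toSet _)
  rw [Set.ncard_coe_finset, Fintype.card_piFinset] at h1
  simp only [Int.card_Icc, Finset.prod_const, Finset.card_univ, Fintype.card_fin] at h1
  refine (Nat.cast_le.mpr h1).trans ?_
  push_cast
  gcongr
  have h2 : 0 ≤ ⌊x⌋ := Int.floor_nonneg.mpr (by linarith)
  have h3 : (((⌊x⌋ + 1 - -⌊x⌋).toNat : ℤ) : ℝ) = 2 * ⌊x⌋ + 1 := by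
    rw [Int.toNat_of_nonneg (by lia)]
    push_cast
    ring
  have h4 := Int.floor_le x
  rw [Int.cast_natCast] at h3
  rw [h3]
  linarith

/-- The nonzero integer points of length at most `x`. -/
def intBallNeZero (p : ENNReal) (r : ℕ) (x : ℝ) : Set (Fin r → ℤ) := intBall p r x \ {0}

lemma one_le_of_mem_intBallNeZero (hp : 1 ≤ p) {x : ℝ} {u : Fin r → ℤ}
    (hu : u ∈ intBallNeZero p r x) : 1 ≤ x := by
  obtain ⟨hu, h0⟩ := hu
  obtain ⟨i, hi⟩ := Function.ne_iff.mp h0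
  refine le_trans ?_ ((abs_apply_le_lpLen hp u i).trans hu)
  exact_mod_cast Int.one_le_abs hi

lemma ncard_intBallNeZero_le (hp : 1 ≤ p) {x : ℝ} (hx : 0 ≤ x) :
    ((intBallNeZero p r x).ncard : ℝ) ≤ (3 * x) ^ r := by
  rcases (intBallNeZero p r x).eq_empty_or_nonempty with h | ⟨u, hu⟩
  · rw [h]
    simp only [Set.ncard_empty, Nat.cast_zero]
    positivity
  · refine le_trans ?_ (ncard_intBall_le hp (one_le_of_mem_intBallNeZero hp hu))
    exact_mod_cast Set.ncard_le_ncard Set.sdiff_subset (intBall_finite hp x)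

lemma ncard_intBallNeZero_eq_zero (hp : 1 ≤ p) {x : ℝ} (hx : x < 1) :
    (intBallNeZero p r x).ncard = 0 := by
  rw [Set.eq_empty_of_forall_notMem fun u hu =>
    (one_le_of_mem_intBallNeZero hp hu).not_gt hx, Set.ncard_empty]

open scoped Pointwise in
lemma exists_tendsto_ncard_intBall (hp : 1 ≤ p) :
    ∃ V : ℝ, 0 < V ∧
      Tendsto (fun x : ℝ => ((intBall p r x).ncard : ℝ) / x ^ r) atTop (nhds V) := by
  have : Fact (1 ≤ p) := ⟨hp⟩
  let S : Set (Fin r → ℝ) := {x | ‖WithLp.toLp p x‖ ≤ 1}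
  have hcont : Continuous fun x : Fin r → ℝ => ‖WithLp.toLp p x‖ :=
    (PiLp.continuous_toLp p _).norm
  have hbdd : Bornology.IsBounded S := by
    refine (Metric.isBounded_closedBall (x := (0 : Fin r → ℝ)) (r := 1)).subset fun x hx => ?_
    rw [mem_closedBall_zero_iff, pi_norm_le_iff_of_nonneg zero_le_one]
    intro i
    exact (PiLp.norm_apply_le (WithLp.toLp p x) i).trans hx
  have hconv : Convex ℝ S := by
    have hS : S = (WithLp.linearEquiv p ℝ (Fin r → ℝ)).symm.toLinearMap ⁻¹'
        Metric.closedBall 0 1 := by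
      ext x
      simp [S]
    rw [hS]
    exact (convex_closedBall (0 : PiLp p fun _ : Fin r => ℝ) 1).linear_preimage _
  have hclosed : IsClosed S := isClosed_le hcont continuous_const
  have hscale : ∀ ⦃x y : ℝ⦄, 0 < x → x ≤ y → x • S ⊆ y • S := by
    intro x y hx hxy
    have hy := hx.trans_le hxy
    rintro _ ⟨a, ha, rfl⟩
    refine (Set.mem_smul_set_iff_inv_smul_mem₀ hy.ne' _ _).mpr ?_
    simp only [S, Set.mem_ofPred_eq, smul_smul, WithLp.toLp_smul, norm_smul] at ha ⊢
    refine mul_le_one₀ ?_ (norm_nonneg _) ha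
    rw [Real.norm_of_nonneg (by positivity), inv_mul_le_one₀ hy]
    exact hxy
  have hpos : 0 < MeasureTheory.volume.real S := by
    refine ENNReal.toReal_pos ?_ hbdd.measure_lt_top.ne
    refine (MeasureTheory.Measure.measure_pos_of_mem_nhds MeasureTheory.volume (x := 0) ?_).ne'
    refine mem_of_superset ((isOpen_lt hcont continuous_const).mem_nhds
      (show ‖WithLp.toLp p (0 : Fin r → ℝ)‖ < 1 by simp)) fun x (hx : ‖WithLp.toLp p x‖ < 1) => hx.le
  refine ⟨_, hpos, ?_⟩
  refine (tendsto_card_div_pow_atTop_volume' S hbdd hclosed.measurableSet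
    (hconv.addHaar_frontier _) hscale).congr' ?_
  filter_upwards [eventually_gt_atTop 0] with x hx
  rw [Fintype.card_fin]
  congr 2
  rw [← Nat.card_coe_set_eq]
  symm
  refine Nat.card_congr (Equiv.ofBijective (fun u => ⟨fun i => x⁻¹ * (u.1 i : ℝ), ?_, ?_⟩) ⟨?_, ?_⟩)
  · have h := u.2
    simp only [intBall, Set.mem_ofPred_eq, lpLen_eq_norm hp] at h
    change ‖WithLp.toLp p (x⁻¹ • fun i => (u.1 i : ℝ))‖ ≤ 1
    rw [WithLp.toLp_smul, norm_smul, Real.norm_of_nonneg (by positivity), inv_mul_le_one₀ hx]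
    exact h
  · refine Set.smul_mem_smul_set (a := x⁻¹) (b := fun i => (u.1 i : ℝ)) ?_
    rw [SetLike.mem_coe, Module.Basis.mem_span_iff_repr_mem]
    intro i
    exact ⟨u.1 i, by simp⟩
  · intro u v huv
    ext i
    have := congrFun (congrArg Subtype.val huv) i
    simpa [hx.ne'] using this
  · rintro ⟨_, hw, y, hy, rfl⟩
    rw [SetLike.mem_coe, Module.Basis.mem_span_iff_repr_mem] at hy
    choose u hu using hy
    have hu' : y = fun i => (u i : ℝ) := by
      ext i
      simpa using (hu i).symm
    subst hu'
    refine ⟨⟨u, ?_⟩, rfl⟩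
    simp only [S, Set.mem_ofPred_eq, WithLp.toLp_smul, norm_smul,
      Real.norm_of_nonneg (inv_nonneg.mpr hx.le), inv_mul_le_one₀ hx] at hw
    simpa only [intBall, Set.mem_ofPred_eq, lpLen_eq_norm hp] using hw

lemma exists_tendsto_ncard_intBallNeZero (hp : 1 ≤ p) (hr : r ≠ 0) :
    ∃ V : ℝ, 0 < V ∧
      Tendsto (fun x : ℝ => ((intBall p r x).ncard : ℝ) / x ^ r) atTop (nhds V) ∧
      Tendsto (fun x : ℝ => ((intBallNeZero p r x).ncard : ℝ) / x ^ r) atTop (nhds V) := by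
  obtain ⟨V, hV, h⟩ := exists_tendsto_ncard_intBall (p := p) (r := r) hp
  refine ⟨V, hV, h, ?_⟩
  have h1 : Tendsto (fun x : ℝ => 1 / x ^ r) atTop (nhds 0) :=
    tendsto_const_nhds.div_atTop (tendsto_pow_atTop hr)
  have h2 := h.sub h1
  rw [sub_zero] at h2
  refine h2.congr' ?_
  filter_upwards [eventually_ge_atTop 0] with x hx
  rw [← sub_div, intBallNeZero,
    Set.ncard_sdiff_singleton_of_mem (zero_mem_intBall hp hx),
    Nat.cast_sub (ncard_intBall_pos hp hx), Nat.cast_one]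

end LpLength

lemma zetaR_eq_tsum {r : ℕ} (hr : 2 ≤ r) : zetaR r = ∑' m : ℕ, 1 / (m : ℝ) ^ r := by
  rw [zetaR, (Real.summable_one_div_nat_pow.mpr hr).tsum_eq_zero_add]
  simp [show r ≠ 0 by lia]

open ArithmeticFunction in
lemma tsum_moebius_div_pow {r : ℕ} (hr : 2 ≤ r) :
    ∑' d : ℕ, (moebius d : ℝ) / (d : ℝ) ^ r = 1 / zetaR r := by
  have hs : 1 < ((r : ℂ)).re := by
    simp only [Complex.natCast_re]
    exact_mod_cast hr
  have h := LSeries_zeta_mul_Lseries_moebius hs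
  rw [LSeries_zeta_eq_riemannZeta hs, zeta_nat_eq_tsum_of_gt_one hr] at h
  have h2 : LSeries (fun n => ((moebius n : ℤ) : ℂ)) r =
      ((∑' d : ℕ, (moebius d : ℝ) / (d : ℝ) ^ r : ℝ) : ℂ) := by
    rw [LSeries, Complex.ofReal_tsum]
    refine tsum_congr fun d => ?_
    rcases eq_or_ne d 0 with rfl | hd
    · simp
    · simp [LSeries.term_of_ne_zero hd]
  have h1 : (∑' m : ℕ, 1 / (m : ℂ) ^ r) = ((zetaR r : ℝ) : ℂ) := by
    rw [zetaR_eq_tsum hr, Complex.ofReal_tsum]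
    simp
  rw [h1, h2] at h
  have h3 : zetaR r * ∑' d : ℕ, (moebius d : ℝ) / (d : ℝ) ^ r = 1 := by exact_mod_cast h
  exact eq_one_div_of_mul_eq_one_right h3

open ArithmeticFunction in
lemma sum_divisors_moebius (m : ℕ) :
    ∑ d ∈ m.divisors, moebius d = if m = 1 then 1 else 0 := by
  rw [← coe_mul_zeta_apply, moebius_mul_coe_zeta, one_apply]

/-- The greatest common divisor of the coordinates of an integer vector. -/
def content {r : ℕ} (u : Fin r → ℤ) : ℕ := (Finset.univ.gcd u).natAbs

lemma dvd_content_iff {r : ℕ} (d : ℕ) (u : Fin r → ℤ) :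
    d ∣ content u ↔ ∃ w : Fin r → ℤ, d • w = u := by
  rw [content, ← Int.natCast_dvd, Finset.dvd_gcd_iff]
  constructor
  · intro h
    choose w hw using fun i => h i (Finset.mem_univ i)
    exact ⟨w, funext fun i => by simp [hw]⟩
  · rintro ⟨w, rfl⟩ i -
    simp

lemma content_ne_zero {r : ℕ} {u : Fin r → ℤ} (hu : u ≠ 0) : content u ≠ 0 := by
  intro h
  obtain ⟨w, rfl⟩ := (dvd_content_iff 0 u).mp (by simp [h])
  simp at hu

lemma exists_hom_of_content_eq_one {r k : ℕ} {u : Fin r → ℤ} (hu : content u = 1)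
    (v : Fin k → ℤ) : ∃ φ : (Fin r → ℤ) →+ (Fin k → ℤ), φ u = v := by
  obtain ⟨g, hg⟩ := Finset.gcd_eq_sum_mul Finset.univ u
  have hone : ∑ i, u i * g i = 1 := by
    rw [← hg, ← Int.natAbs_of_nonneg (a := Finset.univ.gcd u)
      (by rw [← Finset.normalize_gcd]; exact Int.nonneg_of_normalize_eq_self (normalize_idem _))]
    exact_mod_cast hu
  refine ⟨{ toFun := fun w => (∑ i, w i * g i) • v, map_zero' := by simp, map_add' := ?_ }, ?_⟩
  · intro x y
    simp [add_mul, Finset.sum_add_distrib, add_smul]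
  · change (∑ i, u i * g i) • v = v
    rw [hone, one_smul]

/-- The primitive integer points of length at most `x`. -/
def primBall (p : ENNReal) (r : ℕ) (x : ℝ) : Set (Fin r → ℤ) :=
  {u ∈ intBallNeZero p r x | content u = 1}

lemma ncard_intBallNeZero_dvd {p : ENNReal} (hp : 1 ≤ p) {r : ℕ} {d : ℕ} (hd : d ≠ 0) (x : ℝ) :
    {u ∈ intBallNeZero p r x | d ∣ content u}.ncard = (intBallNeZero p r (x / d)).ncard := by
  have hd' : (0 : ℝ) < d := by exact_mod_cast Nat.pos_of_ne_zero hd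
  have hinj : Function.Injective fun w : Fin r → ℤ => d • w := by
    intro a b hab
    ext i
    have := congrFun hab i
    simpa [hd] using this
  rw [← Set.ncard_image_of_injective (intBallNeZero p r (x / d)) hinj]
  congr 1
  ext u
  simp only [Set.mem_ofPred_eq, dvd_content_iff, Set.mem_image, intBallNeZero, intBall,
    Set.mem_sdiff, Set.mem_singleton_iff]
  constructor
  · rintro ⟨⟨h1, h2⟩, w, rfl⟩
    rw [lpLen_nsmul hp] at h1
    refine ⟨w, ⟨?_, ?_⟩, rfl⟩
    · rwa [le_div_iff₀' hd']
    · rintro rfl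
      simp at h2
  · rintro ⟨w, ⟨h1, h2⟩, rfl⟩
    refine ⟨⟨?_, ?_⟩, w, rfl⟩
    · rwa [lpLen_nsmul hp, ← le_div_iff₀' hd']
    · intro h
      exact h2 (hinj (by simpa using h))

lemma content_le {p : ENNReal} (hp : 1 ≤ p) {r : ℕ} {s : ℕ} {u : Fin r → ℤ}
    (hu : u ∈ intBallNeZero p r s) : content u ≤ s := by
  have hc := content_ne_zero hu.2
  have h := ncard_intBallNeZero_dvd hp (r := r) hc (s : ℝ)
  by_contra! hlt
  rw [ncard_intBallNeZero_eq_zero hp (by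
    rw [div_lt_one (by positivity)]
    exact_mod_cast hlt)] at h
  have hfin : {v ∈ intBallNeZero p r s | content u ∣ content v}.Finite :=
    (intBall_finite hp (s : ℝ)).subset fun v hv => hv.1.1
  rw [Set.ncard_eq_zero hfin] at h
  exact (h ▸ ⟨hu, dvd_rfl⟩ : u ∈ (∅ : Set (Fin r → ℤ)))

open ArithmeticFunction in
lemma ncard_primBall_eq_tsum {p : ENNReal} (hp : 1 ≤ p) {r : ℕ} (s : ℕ) :
    ((primBall p r s).ncard : ℝ) =
      ∑' d : ℕ, (moebius d : ℝ) * ((intBallNeZero p r (s / d)).ncard : ℝ) := by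
  classical
  have hfin : (intBallNeZero p r s).Finite := (intBall_finite hp (s : ℝ)).subset Set.sdiff_subset
  let T := hfin.toFinset
  have hcount (P : ℕ → Prop) :
      {u ∈ intBallNeZero p r s | P (content u)}.ncard = ∑ u ∈ T, if P (content u) then 1 else 0 := by
    rw [← Finset.card_filter, ← Set.ncard_coe_finset]
    congr 1
    ext u
    simp [T]
  rw [tsum_eq_sum (s := Finset.Icc 1 s)]
  · have h1 : ∀ d ∈ Finset.Icc 1 s,
        (moebius d : ℝ) * ((intBallNeZero p r (s / d)).ncard : ℝ) =
          ∑ u ∈ T, if d ∣ content u then (moebius d : ℝ) else 0 := by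
      intro d hd
      rw [← ncard_intBallNeZero_dvd hp (by simp at hd; lia), hcount (d ∣ ·)]
      push_cast
      rw [Finset.mul_sum]
      simp
    rw [Finset.sum_congr rfl h1, Finset.sum_comm, primBall, hcount (· = 1)]
    push_cast
    refine Finset.sum_congr rfl fun u hu => ?_
    have hu' : u ∈ intBallNeZero p r s := by simpa [T] using hu
    have hdiv : (Finset.Icc 1 s).filter (· ∣ content u) = (content u).divisors := by
      ext d
      simp only [Finset.mem_filter, Finset.mem_Icc, Nat.mem_divisors]
      constructor
      · exact fun h => ⟨h.2, content_ne_zero hu'.2⟩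
      · exact fun h => ⟨⟨Nat.pos_of_dvd_of_pos h.1 (Nat.pos_of_ne_zero h.2),
          (Nat.le_of_dvd (Nat.pos_of_ne_zero h.2) h.1).trans (content_le hp hu')⟩, h.1⟩
    rw [← Finset.sum_filter, hdiv, ← Int.cast_sum, sum_divisors_moebius]
    simp
  · intro d hd
    rcases eq_or_ne d 0 with rfl | h0
    · simp
    · rw [ncard_intBallNeZero_eq_zero hp]
      · simp
      · have : 0 < d := Nat.pos_of_ne_zero h0
        rw [div_lt_one (by positivity)]
        simp only [Finset.mem_Icc, not_and, not_le] at hd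
        exact_mod_cast hd this

open ArithmeticFunction in
lemma tendsto_primBall_div_intBall {p : ENNReal} (hp : 1 ≤ p) {r : ℕ} (hr : 2 ≤ r) :
    Tendsto (fun s : ℕ => ((primBall p r s).ncard : ℝ) / ((intBall p r s).ncard : ℝ)) atTop
      (nhds (1 / zetaR r)) := by
  obtain ⟨V, hV, hB, hB'⟩ := exists_tendsto_ncard_intBallNeZero (p := p) (r := r) hp (by lia)
  have hprim : Tendsto (fun s : ℕ => ((primBall p r s).ncard : ℝ) / (s : ℝ) ^ r) atTop
      (nhds (1 / zetaR r * V)) := by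
    have key := tendsto_tsum_of_dominated_convergence (𝓕 := atTop)
      (f := fun (s d : ℕ) =>
        (moebius d : ℝ) * ((intBallNeZero p r (s / d)).ncard : ℝ) / (s : ℝ) ^ r)
      (g := fun d : ℕ => (moebius d : ℝ) / (d : ℝ) ^ r * V)
      (bound := fun d : ℕ => 3 ^ r * (1 / (d : ℝ) ^ r))
      ((Real.summable_one_div_nat_pow.mpr hr).mul_left _) ?_ ?_
    · rw [tsum_mul_right, tsum_moebius_div_pow hr] at key
      refine key.congr fun s => ?_
      rw [tsum_div_const, ← ncard_primBall_eq_tsum hp]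
    · intro d
      rcases eq_or_ne d 0 with rfl | hd
      · simp
      have hd' : (0 : ℝ) < d := by exact_mod_cast Nat.pos_of_ne_zero hd
      have h1 : Tendsto (fun s : ℕ => (s : ℝ) / d) atTop atTop :=
        tendsto_natCast_atTop_atTop.atTop_div_const hd'
      refine ((hB'.comp h1).const_mul ((moebius d : ℝ) / (d : ℝ) ^ r)).congr' ?_
      filter_upwards [eventually_gt_atTop 0] with s hs
      simp only [Function.comp, div_pow]
      field_simp
    · filter_upwards [eventually_gt_atTop 0] with s hs d
      rw [norm_div, norm_mul, Real.norm_natCast, Real.norm_of_nonneg (show 0 ≤ (s : ℝ) ^ r by positivity),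
        div_le_iff₀ (by positivity)]
      have hmu : ‖(moebius d : ℝ)‖ ≤ 1 := by
        rw [Real.norm_eq_abs]
        exact_mod_cast abs_moebius_le_one
      have hN := ncard_intBallNeZero_le (r := r) hp (x := (s : ℝ) / d) (by positivity)
      calc _ ≤ 1 * (3 * ((s : ℝ) / d)) ^ r := by gcongr
        _ = _ := by rw [mul_pow, div_pow]; ring
  have h := hprim.div (hB.comp tendsto_natCast_atTop_atTop) hV.ne'
  rw [mul_div_cancel_right₀ _ hV.ne'] at h
  refine h.congr' ?_
  filter_upwards [eventually_gt_atTop 0] with s hs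
  simp only [Function.comp, Pi.div_apply]
  rw [div_div_div_cancel_right₀ (by positivity)]

lemma eRho_pairs_subset {p : ENNReal} {n k s t : ℕ} :
    {uv : (Fin n → ℤ) × (Fin k → ℤ) |
      lpLen p uv.1 ≤ (s : ℝ) ∧ lpLen p uv.2 ≤ (t : ℝ) ∧
      ∃ φ : (Fin n → ℤ) →+ (Fin k → ℤ), φ uv.1 = uv.2} ⊆ intBall p n s ×ˢ intBall p k t :=
  fun _ h => ⟨h.1, h.2.1⟩

lemma eRho_le_one {p : ENNReal} (hp : 1 ≤ p) (n k s t : ℕ) : eRho p n k s t ≤ 1 := by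
  refine div_le_one_of_le₀ ?_ (by positivity)
  have h := Set.ncard_le_ncard (eRho_pairs_subset (p := p) (n := n) (k := k) (s := s) (t := t))
    ((intBall_finite hp _).prod (intBall_finite hp _))
  rw [Set.ncard_prod] at h
  exact_mod_cast h

lemma primBall_div_intBall_le_eRho {p : ENNReal} (hp : 1 ≤ p) (n k s t : ℕ) :
    ((primBall p n s).ncard : ℝ) / ((intBall p n s).ncard : ℝ) ≤ eRho p n k s t := by
  have hk : (0 : ℝ) < (intBall p k t).ncard := by
    exact_mod_cast ncard_intBall_pos hp (Nat.cast_nonneg t)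
  rw [← mul_div_mul_right _ _ hk.ne']
  refine div_le_div_of_nonneg_right ?_ (by positivity)
  have h := Set.ncard_le_ncard (s := primBall p n s ×ˢ intBall p k t)
    (t := {uv : (Fin n → ℤ) × (Fin k → ℤ) | lpLen p uv.1 ≤ (s : ℝ) ∧ lpLen p uv.2 ≤ (t : ℝ) ∧
      ∃ φ : (Fin n → ℤ) →+ (Fin k → ℤ), φ uv.1 = uv.2})
    (fun uv h => ⟨h.1.1.1, h.2, exists_hom_of_content_eq_one h.1.2 uv.2⟩)
    (((intBall_finite hp _).prod (intBall_finite hp _)).subset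
      (eRho_pairs_subset (p := p) (n := n) (k := k) (s := s) (t := t)))
  rw [Set.ncard_prod] at h
  exact_mod_cast h

/-- For `n, k ≥ 2` and `1 ≤ p ≤ ∞`,
`1/ζ(n) ≤ liminf_{(s,t)→(∞,∞)} e_ρ(ℤ^n, ℤ^k, s, t)`. -/
theorem stmt_4 (n k : ℕ) (hn : 2 ≤ n) (hk : 2 ≤ k) (p : ENNReal) (hp : 1 ≤ p) :
    1 / zetaR n ≤
      liminf (fun st : ℕ × ℕ => eRho p n k st.1 st.2) (atTop ×ˢ atTop) := by
  have h : Tendsto (fun st : ℕ × ℕ =>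
      ((primBall p n st.1).ncard : ℝ) / ((intBall p n st.1).ncard : ℝ)) (atTop ×ˢ atTop)
      (nhds (1 / zetaR n)) :=
    (tendsto_primBall_div_intBall hp hn).comp tendsto_fst
  rw [← h.liminf_eq]
  have hbdd : IsBoundedUnder (· ≤ ·) (atTop ×ˢ atTop)
      fun st : ℕ × ℕ => eRho p n k st.1 st.2 :=
    isBoundedUnder_of ⟨1, fun st => eRho_le_one hp n k st.1 st.2⟩
  exact liminf_le_liminf (.of_forall fun st => primBall_div_intBall_le_eRho hp n k st.1 st.2)
    h.isBoundedUnder_ge hbdd.isCoboundedUnder_ge
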